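/- Let P_S, P_T and Q be joint distributions on 𝒵 × 𝒴, and assume Q(z) > 0 for every z ∈ 𝒵 with P_T(z) > 0. Let P_{S+Q} = (1/2)(P_S + Q), let I_{S+Q}(Z₁;Z₂) be the mutual information of the conditionally-i.i.d. pair distribution of P_{S+Q}, let H(Y) be the entropy of the 𝒴-marginal of P_{S+Q}, let d_{HΔH}(P_S(Z), P_T(Z)) be the HΔH-divergence between the 𝒵-marginals of P_S and P_T over the hypothesis class of all functions 𝒵 → 𝒴, and set B = d₁(P_T(Z), Q(Z)) + ε_{P_T}(Q(Y|Z)), where ε_{P_T}(Q(Y|Z)) = Σ_{z : P_T(z)>0} P_T(z) · Σ_y |Q(y|z) − P_T(y|z)| is the risk of the surrogate conditional label distribution. Then for every classifier F : 𝒵 → 𝒴: ε_{P_T}(F) ≤ ε_{P_S}(F) − 4·I_{S+Q}(Z₁;Z₂) + B + (1/2)·d_{HΔH}(P_S(Z), P_T(Z)) + 4·H(Y). -/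

import Mathlib

open Finset

/-- Marginal on `Z` of a joint pmf on `Z × Y`. -/
noncomputable def margZ {Z Y : Type*} [Fintype Y] (P : Z × Y → ℝ) (z : Z) : ℝ :=
  ∑ y, P (z, y)

/-- Marginal on `Y` of a joint pmf on `Z × Y`. -/
noncomputable def margY {Z Y : Type*} [Fintype Z] (P : Z × Y → ℝ) (y : Y) : ℝ :=
  ∑ z, P (z, y)

/-- Expected risk `ε_P(F) = ∑_{z : P(z)>0} P(z) ∑_y |1[y = F z] − P(y|z)|`. -/
noncomputable def risk {Z Y : Type*} [Fintype Z] [Fintype Y] [DecidableEq Y]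
    (P : Z × Y → ℝ) (F : Z → Y) : ℝ :=
  ∑ z ∈ Finset.univ.filter (fun z => 0 < margZ P z),
    margZ P z * ∑ y, |(if y = F z then (1 : ℝ) else 0) - P (z, y) / margZ P z|

/-- Disagreement of two classifiers w.r.t. a distribution on `Z`. -/
noncomputable def disag {Z : Type*} (Y : Type*) [Fintype Z] [Fintype Y] [DecidableEq Y]
    (Pz : Z → ℝ) (F₁ F₂ : Z → Y) : ℝ :=
  ∑ z, Pz z * ∑ y, |(if y = F₁ z then (1 : ℝ) else 0) - (if y = F₂ z then (1 : ℝ) else 0)|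

/-- `HΔH`-divergence over the hypothesis class of all functions `Z → Y`. -/
noncomputable def dHH {Z : Type*} (Y : Type*) [Fintype Z] [Fintype Y] [DecidableEq Y]
    (P₁ P₂ : Z → ℝ) : ℝ :=
  2 * ⨆ F₁ : Z → Y, ⨆ F₂ : Z → Y, |disag Y P₁ F₁ F₂ - disag Y P₂ F₁ F₂|

/-- Mutual information of a joint pmf on `A × B` (natural log). -/
noncomputable def MI {A B : Type*} [Fintype A] [Fintype B] (P : A × B → ℝ) : ℝ :=
  ∑ p ∈ Finset.univ.filter (fun p => 0 < P p),
    P p * Real.log (P p / ((∑ b, P (p.1, b)) * (∑ a, P (a, p.2))))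

/-- Entropy of the `Y`-marginal (natural log, `0 log 0 = 0`). -/
noncomputable def entY {Z Y : Type*} [Fintype Z] [Fintype Y] (P : Z × Y → ℝ) : ℝ :=
  -∑ y, margY P y * Real.log (margY P y)

/-- Conditionally-i.i.d. pair distribution `P⊗(z₁,z₂) = ∑_{y : P(y)>0} P(y) P(z₁|y) P(z₂|y)`. -/
noncomputable def pairDist {Z Y : Type*} [Fintype Z] [Fintype Y] (P : Z × Y → ℝ) :
    Z × Z → ℝ := fun p =>
  ∑ y ∈ Finset.univ.filter (fun y => 0 < margY P y),
    margY P y * (P (p.1, y) / margY P y) * (P (p.2, y) / margY P y)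

/-- Kullback–Leibler divergence of finite pmfs (natural log). -/
noncomputable def KL {X : Type*} [Fintype X] (p q : X → ℝ) : ℝ :=
  ∑ x ∈ Finset.univ.filter (fun x => 0 < p x), p x * Real.log (p x / q x)

section JointDistribution

variable {Z Y : Type*}

lemma margZ_nonneg [Fintype Y] {P : Z × Y → ℝ} (hP : ∀ p, 0 ≤ P p) (z : Z) : 0 ≤ margZ P z :=
  sum_nonneg fun _ _ => hP _

lemma margY_nonneg [Fintype Z] {P : Z × Y → ℝ} (hP : ∀ p, 0 ≤ P p) (y : Y) : 0 ≤ margY P y :=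
  sum_nonneg fun _ _ => hP _

lemma le_margZ [Fintype Y] {P : Z × Y → ℝ} (hP : ∀ p, 0 ≤ P p) (z : Z) (y : Y) :
    P (z, y) ≤ margZ P z :=
  single_le_sum (f := fun y => P (z, y)) (fun _ _ => hP _) (mem_univ y)

lemma le_margY [Fintype Z] {P : Z × Y → ℝ} (hP : ∀ p, 0 ≤ P p) (z : Z) (y : Y) :
    P (z, y) ≤ margY P y :=
  single_le_sum (f := fun z => P (z, y)) (fun _ _ => hP _) (mem_univ z)

lemma sum_margZ [Fintype Z] [Fintype Y] (P : Z × Y → ℝ) : ∑ z, margZ P z = ∑ p, P p :=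
  (Fintype.sum_prod_type P).symm

/-- The `ℓ¹`-distance from a point mass to a probability vector. -/
lemma sum_abs_indicator_sub [Fintype Y] [DecidableEq Y] {w : Y → ℝ} (h0 : ∀ y, 0 ≤ w y)
    (h1 : ∑ y, w y = 1) (k : Y) :
    ∑ y, |(if y = k then (1 : ℝ) else 0) - w y| = 2 * (1 - w k) := by
  have hk : w k ≤ 1 := h1 ▸ single_le_sum (fun y _ => h0 y) (mem_univ k)
  have h : ∀ y, |(if y = k then (1 : ℝ) else 0) - w y|
      = w y + (if y = k then 1 - 2 * w k else 0) := by
    intro y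
    split_ifs with hy
    · subst hy
      rw [abs_of_nonneg (by linarith)]; ring
    · rw [zero_sub, abs_neg, abs_of_nonneg (h0 y), add_zero]
  simp only [h, sum_add_distrib, h1, sum_ite_eq', mem_univ, if_true]
  ring

lemma sum_abs_indicator_sub_cond [Fintype Y] [DecidableEq Y] {P : Z × Y → ℝ}
    (hP : ∀ p, 0 ≤ P p) {z : Z} (hz : 0 < margZ P z) (k : Y) :
    ∑ y, |(if y = k then (1 : ℝ) else 0) - P (z, y) / margZ P z|
      = 2 * (1 - P (z, k) / margZ P z) :=
  sum_abs_indicator_sub (w := fun y => P (z, y) / margZ P z)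
    (fun _ => div_nonneg (hP _) hz.le)
    (by rw [← sum_div]; exact div_self hz.ne') k

lemma risk_eq [Fintype Z] [Fintype Y] [DecidableEq Y] {P : Z × Y → ℝ}
    (hP : ∀ p, 0 ≤ P p) (F : Z → Y) :
    risk P F = 2 * ∑ z, (margZ P z - P (z, F z)) := by
  rw [risk, sum_filter, mul_sum]
  refine sum_congr rfl fun z _ => ?_
  split_ifs with hz
  · rw [sum_abs_indicator_sub_cond hP hz]
    field_simp
  · have h1 := le_margZ hP z (F z)
    have h2 := hP (z, F z)
    linarith [not_lt.mp hz, margZ_nonneg hP z]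

/-- Passing from `Q` to `P` costs at most the `ℓ¹`-distance of the marginals plus the risk of the
conditional label distribution of `Q`. -/
lemma risk_le_risk_add [Fintype Z] [Fintype Y] [DecidableEq Y] {P Q : Z × Y → ℝ}
    (hP : ∀ p, 0 ≤ P p) (hQ : ∀ p, 0 ≤ Q p) (hPQ : ∑ p, P p = ∑ p, Q p)
    (hpos : ∀ z, 0 < margZ P z → 0 < margZ Q z) (F : Z → Y) :
    risk P F ≤ risk Q F + ((∑ z, |margZ P z - margZ Q z|)
      + ∑ z ∈ univ.filter (fun z => 0 < margZ P z),
          margZ P z * ∑ y, |Q (z, y) / margZ Q z - P (z, y) / margZ P z|) := by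
  set r : Z → ℝ := fun z => 2 * (1 - Q (z, F z) / margZ Q z) with hr
  have hsplit : risk P F ≤ ∑ z, margZ P z * r z
      + ∑ z ∈ univ.filter (fun z => 0 < margZ P z),
          margZ P z * ∑ y, |Q (z, y) / margZ Q z - P (z, y) / margZ P z| := by
    have h : ∑ z, margZ P z * r z
        = ∑ z ∈ univ.filter (fun z => 0 < margZ P z), margZ P z * r z := by
      rw [sum_filter]
      refine sum_congr rfl fun z _ => ?_
      split_ifs with hz
      · rfl
      · rw [le_antisymm (not_lt.mp hz) (margZ_nonneg hP z), zero_mul]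
    rw [h, ← sum_add_distrib, risk]
    refine sum_le_sum fun z hz => ?_
    have hz : 0 < margZ P z := (mem_filter.mp hz).2
    rw [← mul_add]
    refine mul_le_mul_of_nonneg_left ?_ hz.le
    simp only [hr]
    rw [← sum_abs_indicator_sub_cond hQ (hpos z hz) (F z), ← sum_add_distrib]
    exact sum_le_sum fun y _ => abs_sub_le _ _ _
  have hshift : ∑ z, margZ P z * r z ≤ risk Q F + ∑ z, |margZ P z - margZ Q z| := by
    have h : ∀ z, margZ P z * r z ≤ 2 * (margZ Q z - Q (z, F z)) + |margZ P z - margZ Q z|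
        + (margZ P z - margZ Q z) := by
      intro z
      have hw0 : 0 ≤ Q (z, F z) / margZ Q z := div_nonneg (hQ _) (margZ_nonneg hQ z)
      have hw1 : Q (z, F z) / margZ Q z ≤ 1 :=
        div_le_one_of_le₀ (le_margZ hQ z _) (margZ_nonneg hQ z)
      have hr1 : |r z - 1| ≤ 1 :=
        abs_le.mpr ⟨by simp only [hr]; linarith, by simp only [hr]; linarith⟩
      have hqr : margZ Q z * r z = 2 * (margZ Q z - Q (z, F z)) := by
        have : margZ Q z * (Q (z, F z) / margZ Q z) = Q (z, F z) :=
          mul_div_cancel_of_imp' fun h0 =>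
            le_antisymm (h0 ▸ le_margZ hQ z (F z)) (hQ _)
        simp only [hr]
        linear_combination (-2) * this
      have hprod : (margZ P z - margZ Q z) * (r z - 1) ≤ |margZ P z - margZ Q z| :=
        (le_abs_self _).trans <| by
          rw [abs_mul]
          exact mul_le_of_le_one_right (abs_nonneg _) hr1
      linarith
    have hsum := sum_le_sum fun z (_ : z ∈ univ) => h z
    rw [sum_add_distrib, sum_add_distrib, ← mul_sum, ← risk_eq hQ, sum_sub_distrib, sum_margZ,
      sum_margZ, hPQ] at hsum
    linarith
  linarith

lemma risk_le_risk_add_disag [Fintype Z] [Fintype Y] [DecidableEq Y] {P : Z × Y → ℝ}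
    (hP : ∀ p, 0 ≤ P p) (F G : Z → Y) :
    risk P F ≤ risk P G + disag Y (margZ P) F G := by
  rw [risk, risk, disag, sum_filter, sum_filter, ← sum_add_distrib]
  refine sum_le_sum fun z _ => ?_
  split_ifs with hz
  · rw [← mul_add, ← sum_add_distrib]
    refine mul_le_mul_of_nonneg_left (sum_le_sum fun y _ => ?_) hz.le
    rw [add_comm]
    exact abs_sub_le _ _ _
  · rw [zero_add]
    exact mul_nonneg (margZ_nonneg hP z) (sum_nonneg fun _ _ => abs_nonneg _)

lemma disag_le_risk_add_risk [Fintype Z] [Fintype Y] [DecidableEq Y] {P : Z × Y → ℝ}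
    (hP : ∀ p, 0 ≤ P p) (F G : Z → Y) :
    disag Y (margZ P) F G ≤ risk P F + risk P G := by
  rw [risk, risk, disag, sum_filter, sum_filter, ← sum_add_distrib]
  refine sum_le_sum fun z _ => ?_
  split_ifs with hz
  · rw [← mul_add, ← sum_add_distrib]
    refine mul_le_mul_of_nonneg_left (sum_le_sum fun y _ => ?_) hz.le
    rw [abs_sub_comm (if y = G z then (1 : ℝ) else 0) (P (z, y) / margZ P z)]
    exact abs_sub_le _ _ _
  · rw [le_antisymm (not_lt.mp hz) (margZ_nonneg hP z)]
    simp

lemma abs_disag_sub_le_dHH [Fintype Z] [Fintype Y] [DecidableEq Y] (P₁ P₂ : Z → ℝ)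
    (F G : Z → Y) :
    |disag Y P₁ F G - disag Y P₂ F G| ≤ (1 / 2) * dHH Y P₁ P₂ := by
  have h1 := le_ciSup (Set.finite_range fun F₂ : Z → Y =>
    |disag Y P₁ F F₂ - disag Y P₂ F F₂|).bddAbove G
  have h2 := le_ciSup (Set.finite_range fun F₁ : Z → Y =>
    ⨆ F₂ : Z → Y, |disag Y P₁ F₁ F₂ - disag Y P₂ F₁ F₂|).bddAbove F
  rw [dHH]
  linarith

lemma pairDist_apply [Fintype Z] [Fintype Y] {P : Z × Y → ℝ} (hP : ∀ p, 0 ≤ P p) (a b : Z) :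
    pairDist P (a, b) = ∑ y, P (a, y) * P (b, y) / margY P y := by
  rw [pairDist, sum_filter]
  refine sum_congr rfl fun y _ => ?_
  split_ifs with hy
  · field_simp
  · rw [le_antisymm (not_lt.mp hy) (margY_nonneg hP y), div_zero]

lemma pairDist_nonneg [Fintype Z] [Fintype Y] {P : Z × Y → ℝ} (hP : ∀ p, 0 ≤ P p) (p : Z × Z) :
    0 ≤ pairDist P p := by
  rw [← Prod.mk.eta (p := p), pairDist_apply hP]
  exact sum_nonneg fun y _ => div_nonneg (mul_nonneg (hP _) (hP _)) (margY_nonneg hP y)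

lemma sum_mul_div_margY [Fintype Z] {P : Z × Y → ℝ} (hP : ∀ p, 0 ≤ P p) (b : Z) (y : Y) :
    ∑ a, P (a, y) * P (b, y) / margY P y = P (b, y) := by
  rw [← sum_div, ← sum_mul]
  exact mul_div_cancel_left_of_imp fun h => le_antisymm (h ▸ le_margY hP b y) (hP _)

lemma sum_pairDist_left [Fintype Z] [Fintype Y] {P : Z × Y → ℝ} (hP : ∀ p, 0 ≤ P p) (b : Z) :
    ∑ a, pairDist P (a, b) = margZ P b := by
  simp only [pairDist_apply hP]
  rw [sum_comm]
  exact sum_congr rfl fun y _ => sum_mul_div_margY hP b y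

lemma sum_pairDist_right [Fintype Z] [Fintype Y] {P : Z × Y → ℝ} (hP : ∀ p, 0 ≤ P p) (a : Z) :
    ∑ b, pairDist P (a, b) = margZ P a := by
  rw [← sum_pairDist_left hP a]
  simp only [pairDist_apply hP, mul_comm]

lemma MI_pairDist [Fintype Z] [Fintype Y] {P : Z × Y → ℝ} (hP : ∀ p, 0 ≤ P p) :
    MI (pairDist P) = ∑ b, ∑ a, pairDist P (a, b) *
      Real.log (pairDist P (a, b) / (margZ P a * margZ P b)) := by
  rw [MI, sum_filter, Fintype.sum_prod_type_right]
  refine sum_congr rfl fun b _ => sum_congr rfl fun a _ => ?_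
  simp only [sum_pairDist_left hP, sum_pairDist_right hP]
  split_ifs with h
  · rfl
  · rw [le_antisymm (not_lt.mp h) (pairDist_nonneg hP _), zero_mul]

/-- The Gibbs-type pointwise bound behind the data-processing inequality for the pair. -/
lemma mul_log_add_log_le {u v p q m c : ℝ} (hu : 0 ≤ u) (hv : 0 ≤ v) (hvp : v ≤ p)
    (hvq : v ≤ q) (hvm : v ≤ m) (hc : 0 ≤ c) (hc0 : c = 0 → u * v / q = 0) :
    u * v / q * (Real.log c + Real.log q) ≤ u * v / q * (m / p - 1) + (u * p * c - u * v / q) := by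
  rcases eq_or_ne (u * v / q) 0 with h | h
  · rw [h]
    have := mul_nonneg (mul_nonneg hu (hv.trans hvp)) hc
    linarith
  have hu' : 0 < u := lt_of_le_of_ne hu (by rintro rfl; simp at h)
  have hv' : 0 < v := lt_of_le_of_ne hv (by rintro rfl; simp at h)
  have hc' : 0 < c := lt_of_le_of_ne hc fun h0 => h (hc0 h0.symm)
  have hp : 0 < p := hv'.trans_le hvp
  have hq : 0 < q := hv'.trans_le hvq
  have h1 : Real.log (v / p) ≤ m / p - 1 :=
    (Real.log_le_sub_one_of_pos (by positivity)).trans (by gcongr)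
  have h2 : Real.log (c * q / (v / p)) ≤ c * q / (v / p) - 1 :=
    Real.log_le_sub_one_of_pos (by positivity)
  rw [Real.log_div (by positivity) (by positivity), Real.log_mul hc'.ne' hq.ne'] at h2
  calc u * v / q * (Real.log c + Real.log q)
      ≤ u * v / q * ((m / p - 1) + (c * q / (v / p) - 1)) := by
        refine mul_le_mul_of_nonneg_left ?_ (by positivity)
        linarith
    _ = u * v / q * (m / p - 1) + (u * p * c - u * v / q) := by
        field_simp

/-- The Bayes error is at most the entropy of the label minus the mutual information of the
conditionally-i.i.d. pair. -/
lemma bayes_error_le [Fintype Z] [Fintype Y] {P : Z × Y → ℝ} (hP : ∀ p, 0 ≤ P p)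
    {G : Z → Y} (hG : ∀ z y, P (z, y) ≤ P (z, G z)) :
    ∑ z, (margZ P z - P (z, G z)) ≤ entY P - MI (pairDist P) := by
  have hpair : ∀ a b, pairDist P (a, b) *
        Real.log (pairDist P (a, b) / (margZ P a * margZ P b))
      + ∑ y, P (a, y) * P (b, y) / margY P y * Real.log (margY P y)
      ≤ pairDist P (a, b) * (P (b, G b) / margZ P b - 1) := by
    intro a b
    have hpp : 0 ≤ margZ P a * margZ P b := mul_nonneg (margZ_nonneg hP a) (margZ_nonneg hP b)
    have hzero : margZ P a * margZ P b = 0 → ∀ y, P (a, y) * P (b, y) = 0 := fun h y =>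
      le_antisymm (h ▸ mul_le_mul (le_margZ hP a y) (le_margZ hP b y) (hP _) (margZ_nonneg hP a))
        (mul_nonneg (hP _) (hP _))
    set c := pairDist P (a, b) / (margZ P a * margZ P b) with hc
    have hpc : margZ P a * margZ P b * c = pairDist P (a, b) :=
      mul_div_cancel_of_imp' fun h => by simp [pairDist_apply hP, hzero h]
    have hsum := sum_le_sum fun y (_ : y ∈ univ) =>
      mul_log_add_log_le (c := c) (hP (a, y)) (hP (b, y)) (le_margZ hP b y) (le_margY hP b y)
        (hG b y) (div_nonneg (pairDist_nonneg hP _) hpp) (by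
          intro h0
          rw [h0, mul_zero, pairDist_apply hP] at hpc
          exact (sum_eq_zero_iff_of_nonneg fun y _ =>
            div_nonneg (mul_nonneg (hP _) (hP _)) (margY_nonneg hP y)).mp hpc.symm y (mem_univ y))
    simp only [mul_add, sum_add_distrib, sum_sub_distrib, ← sum_mul] at hsum
    rw [← pairDist_apply hP] at hsum
    have hmarg : (∑ y, P (a, y)) = margZ P a := rfl
    rw [hmarg] at hsum
    linarith
  have htotal := sum_le_sum fun b (_ : b ∈ univ) => sum_le_sum fun a (_ : a ∈ univ) => hpair a b
  simp only [sum_add_distrib, ← sum_mul, sum_pairDist_left hP] at htotal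
  rw [← MI_pairDist hP] at htotal
  have hent : ∑ b, ∑ a, ∑ y, P (a, y) * P (b, y) / margY P y * Real.log (margY P y)
      = -entY P := by
    rw [entY, neg_neg]
    calc _ = ∑ b, ∑ y, P (b, y) * Real.log (margY P y) := by
          refine sum_congr rfl fun b _ => ?_
          rw [sum_comm]
          refine sum_congr rfl fun y _ => ?_
          rw [← sum_mul, sum_mul_div_margY hP]
      _ = _ := by
          rw [sum_comm]
          refine sum_congr rfl fun y _ => ?_
          rw [← sum_mul]
          rfl
  have hmax : ∑ b, margZ P b * (P (b, G b) / margZ P b - 1)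
      = -∑ z, (margZ P z - P (z, G z)) := by
    rw [← sum_neg_distrib]
    refine sum_congr rfl fun b _ => ?_
    have : margZ P b * (P (b, G b) / margZ P b) = P (b, G b) :=
      mul_div_cancel_of_imp' fun h => le_antisymm (h ▸ le_margZ hP b (G b)) (hP _)
    linear_combination this
  rw [hent, hmax] at htotal
  linarith

end JointDistribution

theorem surrogate_target_risk_bound {Z Y : Type*} [Fintype Z] [Fintype Y] [Nonempty Z] [Nonempty Y]
    [DecidableEq Y]
    (PS PT Q : Z × Y → ℝ)
    (hS0 : ∀ p, 0 ≤ PS p) (hS1 : ∑ p, PS p = 1)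
    (hT0 : ∀ p, 0 ≤ PT p) (hT1 : ∑ p, PT p = 1)
    (hQ0 : ∀ p, 0 ≤ Q p) (hQ1 : ∑ p, Q p = 1)
    (hQpos : ∀ z, 0 < margZ PT z → 0 < margZ Q z)
    (F : Z → Y) :
    risk PT F ≤ risk PS F
      - 4 * MI (pairDist (fun p => (1 / 2) * (PS p + Q p)))
      + ((∑ z, |margZ PT z - margZ Q z|)
          + ∑ z ∈ Finset.univ.filter (fun z => 0 < margZ PT z),
              margZ PT z * ∑ y, |Q (z, y) / margZ Q z - PT (z, y) / margZ PT z|)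
      + (1 / 2) * dHH Y (margZ PS) (margZ PT)
      + 4 * entY (fun p => (1 / 2) * (PS p + Q p)) := by
  set M : Z × Y → ℝ := fun p => (1 / 2) * (PS p + Q p) with hM
  have hM0 : ∀ p, 0 ≤ M p := fun p => mul_nonneg (by norm_num) (add_nonneg (hS0 p) (hQ0 p))
  choose G hG using fun z => Finite.exists_max fun y => M (z, y)
  have hbayes := bayes_error_le hM0 hG
  have hmix : risk PS G + risk Q G = 4 * ∑ z, (margZ M z - M (z, G z)) := by
    rw [risk_eq hS0, risk_eq hQ0, mul_sum, mul_sum, mul_sum, ← sum_add_distrib]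
    refine sum_congr rfl fun z _ => ?_
    simp only [margZ, hM, ← mul_sum, sum_add_distrib]
    ring
  have htarget := risk_le_risk_add hT0 hQ0 (hT1.trans hQ1.symm) hQpos G
  have hFG := risk_le_risk_add_disag hT0 F G
  have hsource := disag_le_risk_add_risk hS0 F G
  have hdiv := (abs_le.mp (abs_disag_sub_le_dHH (margZ PS) (margZ PT) F G)).1
  linarith
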